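/- Let a₀, a₁₂₃ be real numbers with a₀ - a₁₂₃ > 0 and a₀ + a₁₂₃ > 0, and let Û₁, Û₂ be any bivectors of Cl(0,3) with Û₁² = -1 and Û₂² = -1. Then for any integers c₁, c₂, exp( ((1/2)·log(a₀ - a₁₂₃) + πc₁Û₁)·(1 - I) + ((1/2)·log(a₀ + a₁₂₃) + πc₂Û₂)·(1 + I) ) = a₀ + a₁₂₃·I. -/

import Mathlib

open Real CliffordAlgebra

noncomputable section

/-- The quadratic form of signature (0,3): `Q(x) = -(x₁² + x₂² + x₃²)`. -/
def Q03 : QuadraticForm ℝ (Fin 3 → ℝ) := QuadraticMap.weightedSumSquares ℝ ![-1, -1, -1]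

/-- The real Clifford algebra Cl(0,3). -/
abbrev Cl03 := CliffordAlgebra Q03

/-- The canonical (module) topology on the finite-dimensional real algebra Cl(0,3). -/
instance : TopologicalSpace Cl03 := moduleTopology ℝ Cl03

/-- The orthonormal generators `e₁, e₂, e₃` (indexed here by `0, 1, 2`). -/
def e (i : Fin 3) : Cl03 := ι Q03 (Pi.single i 1)

/-- The pseudoscalar `I = e₁e₂e₃`. -/
def I3 : Cl03 := e 0 * e 1 * e 2

/-- The exponential `exp M = ∑ₖ Mᵏ/k!` in Cl(0,3). -/
def expCl (M : Cl03) : Cl03 := ∑' n : ℕ, (n.factorial : ℝ)⁻¹ • M ^ n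

/-- `atan2 y x` is the argument in `(-π, π]` of the complex number `x + iy`. -/
def atan2 (y x : ℝ) : ℝ := Complex.arg ⟨x, y⟩

lemma e_mul_self (i : Fin 3) : e i * e i = -1 := by
  have hQ : Q03 (Pi.single i 1) = -1 := by
    fin_cases i <;> simp [Q03, QuadraticMap.weightedSumSquares_apply, Fin.sum_univ_three]
  rw [e, ι_sq_scalar, hQ, map_neg, map_one]

lemma e_mul_e_swap {i j : Fin 3} (h : i ≠ j) : e j * e i = -(e i * e j) := by
  have hQ : QuadraticMap.polar Q03 (Pi.single j 1) (Pi.single i 1) = 0 := by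
    fin_cases i <;> fin_cases j <;>
      simp_all [Q03, QuadraticMap.polar, QuadraticMap.weightedSumSquares_apply, Fin.sum_univ_three]
  rw [eq_neg_iff_add_eq_zero, e, e, ι_mul_ι_add_swap, hQ, map_zero]

lemma e_mul_self_assoc (i : Fin 3) (x : Cl03) : e i * (e i * x) = -x := by
  rw [← mul_assoc, e_mul_self, neg_one_mul]

lemma e_mul_e_swap_assoc {i j : Fin 3} (h : i ≠ j) (x : Cl03) :
    e j * (e i * x) = -(e i * (e j * x)) := by
  rw [← mul_assoc, e_mul_e_swap h, neg_mul, mul_assoc]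

lemma I3_mul_self : I3 * I3 = 1 := by
  simp [I3, mul_assoc, e_mul_self,
    e_mul_e_swap_assoc (show (0 : Fin 3) ≠ 1 by decide),
    e_mul_e_swap_assoc (show (0 : Fin 3) ≠ 2 by decide),
    e_mul_e_swap_assoc (show (1 : Fin 3) ≠ 2 by decide)]

lemma commute_I3_e (i : Fin 3) : Commute I3 (e i) := by
  fin_cases i <;>
  simp [Commute, SemiconjBy, I3, mul_assoc, e_mul_self, e_mul_self_assoc,
    e_mul_e_swap (show (0 : Fin 3) ≠ 2 by decide),
    e_mul_e_swap (show (1 : Fin 3) ≠ 2 by decide),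
    e_mul_e_swap_assoc (show (0 : Fin 3) ≠ 1 by decide),
    e_mul_e_swap_assoc (show (0 : Fin 3) ≠ 2 by decide),
    e_mul_e_swap_assoc (show (1 : Fin 3) ≠ 2 by decide)]

lemma commute_I3_bivector (a b c : ℝ) :
    Commute I3 (a • (e 0 * e 1) + b • (e 0 * e 2) + c • (e 1 * e 2)) :=
  (((((commute_I3_e 0).mul_right (commute_I3_e 1)).smul_right a).add_right
    (((commute_I3_e 0).mul_right (commute_I3_e 2)).smul_right b))).add_right
    (((commute_I3_e 1).mul_right (commute_I3_e 2)).smul_right c)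

instance : IsModuleTopology ℝ Cl03 := ⟨rfl⟩

instance : IsTopologicalAddGroup Cl03 := IsModuleTopology.topologicalAddGroup ℝ Cl03

instance : T2Space Cl03 := by
  let b := Module.Free.chooseBasis ℝ Cl03
  let f : Cl03 →ₗ[ℝ] (Module.Free.ChooseBasisIndex ℝ Cl03 → ℝ) := LinearMap.pi fun i => b.coord i
  refine T2Space.of_injective_continuous (f := f) (fun x y h => ?_)
    (IsModuleTopology.continuous_of_linearMap f)
  exact b.ext_elem fun i => congrFun h i

/-- Powers decompose along a pair of complementary orthogonal idempotents. -/
lemma add_pow_of_complementary_idempotents {A : Type*} [Ring A] {p q x y : A}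
    (hpp : p * p = p) (hqq : q * q = q) (hpq : p * q = 0) (hqp : q * p = 0) (hadd : p + q = 1)
    (hx : Commute p x) (hy : Commute q y) (n : ℕ) :
    (x * p + y * q) ^ n = x ^ n * p + y ^ n * q := by
  induction n with
  | zero => simp [hadd]
  | succ n ih =>
    have h₁ : x ^ n * p * (x * p) = x ^ (n + 1) * p := by
      rw [← hx.eq, mul_assoc, ← mul_assoc p, hpp, hx.eq, ← mul_assoc, pow_succ]
    have h₂ : x ^ n * p * (y * q) = 0 := by
      rw [← hy.eq, mul_assoc, ← mul_assoc p, hpq, zero_mul, mul_zero]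
    have h₃ : y ^ n * q * (x * p) = 0 := by
      rw [← hx.eq, mul_assoc, ← mul_assoc q, hqp, zero_mul, mul_zero]
    have h₄ : y ^ n * q * (y * q) = y ^ (n + 1) * q := by
      rw [← hy.eq, mul_assoc, ← mul_assoc q, hqq, hy.eq, ← mul_assoc, pow_succ]
    rw [pow_succ, ih, add_mul, mul_add, mul_add, h₁, h₂, h₃, h₄, add_zero, zero_add]

lemma commute_complexLift {p U : Cl03} (hU : U * U = -1) (h : Commute p U) (z : ℂ) :
    Commute p (Complex.lift ⟨U, hU⟩ z) := by
  rw [Complex.lift_apply, Complex.liftAux_apply]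
  exact (Algebra.commute_algebraMap_right _ _).add_right (h.smul_right _)

/-- The exponential series of `z`, mapped to `Cl(0,3)` along `i ↦ U` and multiplied by `p`. -/
lemma hasSum_complexLift_exp_mul {U : Cl03} (hU : U * U = -1) (p : Cl03) (z : ℂ) :
    HasSum (fun n : ℕ => (n.factorial : ℝ)⁻¹ • ((Complex.lift ⟨U, hU⟩ z) ^ n * p))
      (Complex.lift ⟨U, hU⟩ (Complex.exp z) * p) := by
  let f : ℂ →ₗ[ℝ] Cl03 :=
    (LinearMap.mulRight ℝ p).comp (Complex.lift ⟨U, hU⟩ : ℂ →ₐ[ℝ] Cl03).toLinearMap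
  have hs : HasSum (fun n : ℕ => (n.factorial : ℝ)⁻¹ • z ^ n) (Complex.exp z) := by
    rw [Complex.exp_eq_exp_ℂ]
    exact NormedSpace.exp_series_hasSum_exp' (𝕂 := ℝ) z
  have := hs.map f f.continuous_of_finiteDimensional
  have hf (w : ℂ) : f w = Complex.lift ⟨U, hU⟩ w * p := rfl
  simpa only [Function.comp_def, map_smul, smul_mul_assoc, hf, map_pow] using this

lemma exp_log_add_two_pi_mul_int {a : ℝ} (ha : 0 < a) (c : ℤ) :
    Complex.exp ⟨Real.log a, 2 * (π * c)⟩ = a := by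
  have : (⟨Real.log a, 2 * (π * c)⟩ : ℂ) = (Real.log a : ℂ) + c * (2 * π * Complex.I) := by
    apply Complex.ext <;> simp
    ring
  rw [this, Complex.exp_add, Complex.exp_int_mul_two_pi_mul_I, mul_one, ← Complex.ofReal_exp,
    Real.exp_log ha]

/-- exponential of the logarithm of an element `a₀ + a₁₂₃ I` of the
center of Cl(0,3), in the case `a₀ - a₁₂₃ > 0` and `a₀ + a₁₂₃ > 0`. -/
theorem exp_log_center_Cl03
    (a0 a123 d12 d13 d23 f12 f13 f23 : ℝ) (c1 c2 : ℤ) (U1 U2 : Cl03)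
    (hU1 : U1 = d12 • (e 0 * e 1) + d13 • (e 0 * e 2) + d23 • (e 1 * e 2))
    (hU2 : U2 = f12 • (e 0 * e 1) + f13 • (e 0 * e 2) + f23 • (e 1 * e 2))
    (hU1sq : U1 * U1 = -1) (hU2sq : U2 * U2 = -1)
    (hm : 0 < a0 - a123) (hp : 0 < a0 + a123) :
    expCl ((algebraMap ℝ Cl03 ((1 / 2) * Real.log (a0 - a123)) + (π * c1) • U1) * (1 - I3) +
      (algebraMap ℝ Cl03 ((1 / 2) * Real.log (a0 + a123)) + (π * c2) • U2) * (1 + I3)) =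
      algebraMap ℝ Cl03 a0 + a123 • I3 := by
  subst hU1 hU2
  set U1 := d12 • (e 0 * e 1) + d13 • (e 0 * e 2) + d23 • (e 1 * e 2)
  set U2 := f12 • (e 0 * e 1) + f13 • (e 0 * e 2) + f23 • (e 1 * e 2)
  let p : Cl03 := (1 / 2 : ℝ) • (1 - I3)
  let q : Cl03 := (1 / 2 : ℝ) • (1 + I3)
  have hpp : p * p = p := by
    simp only [p, smul_mul_smul_comm, sub_mul, mul_sub, one_mul, mul_one, I3_mul_self]
    module
  have hqq : q * q = q := by
    simp only [q, smul_mul_smul_comm, add_mul, mul_add, one_mul, mul_one, I3_mul_self]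
    module
  have hpq : p * q = 0 := by
    simp only [p, q, smul_mul_smul_comm, sub_mul, mul_add, one_mul, mul_one, I3_mul_self]
    module
  have hqp : q * p = 0 := by
    simp only [p, q, smul_mul_smul_comm, add_mul, mul_sub, one_mul, mul_one, I3_mul_self]
    module
  have hadd : p + q = 1 := by
    simp only [p, q]
    module
  have hp1 : Commute p U1 :=
    ((Commute.one_left _).sub_left (commute_I3_bivector d12 d13 d23)).smul_left _
  have hq2 : Commute q U2 :=
    ((Commute.one_left _).add_left (commute_I3_bivector f12 f13 f23)).smul_left _
  let x : Cl03 := Complex.lift ⟨U1, hU1sq⟩ ⟨Real.log (a0 - a123), 2 * (π * c1)⟩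
  let y : Cl03 := Complex.lift ⟨U2, hU2sq⟩ ⟨Real.log (a0 + a123), 2 * (π * c2)⟩
  have hM : (algebraMap ℝ Cl03 ((1 / 2) * Real.log (a0 - a123)) + (π * c1) • U1) * (1 - I3) +
      (algebraMap ℝ Cl03 ((1 / 2) * Real.log (a0 + a123)) + (π * c2) • U2) * (1 + I3) =
      x * p + y * q := by
    simp only [x, y, p, q, Complex.lift_apply, Complex.liftAux_apply, mul_smul_comm,
      ← smul_mul_assoc, Algebra.algebraMap_eq_smul_one]
    congr 2 <;> module
  have hs := (hasSum_complexLift_exp_mul hU1sq p ⟨Real.log (a0 - a123), 2 * (π * c1)⟩).add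
    (hasSum_complexLift_exp_mul hU2sq q ⟨Real.log (a0 + a123), 2 * (π * c2)⟩)
  have hterm (n : ℕ) : (x * p + y * q) ^ n = x ^ n * p + y ^ n * q :=
    add_pow_of_complementary_idempotents hpp hqq hpq hqp hadd
      (commute_complexLift hU1sq hp1 _) (commute_complexLift hU2sq hq2 _) n
  rw [hM, expCl]
  simp only [hterm, smul_add]
  rw [hs.tsum_eq, exp_log_add_two_pi_mul_int hm, exp_log_add_two_pi_mul_int hp]
  simp only [Complex.lift_apply, Complex.liftAux_apply, Complex.ofReal_re, Complex.ofReal_im,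
    zero_smul, add_zero, p, q, Algebra.algebraMap_eq_smul_one, smul_mul_assoc, one_mul]
  module
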